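/- Let G be a finite group. For every integer n ≥ 0 and every g ∈ G, the permutation x^n·σ_g·x^{−n} of G^ω has depth n+1 when g ≠ 1: it changes only the first n+1 letters, i.e., for every w ∈ G^ω and every index k > n one has (x^n·σ_g·x^{−n}(w))_k = w_k, and moreover if g ≠ 1 then there exists w ∈ G^ω with (x^n·σ_g·x^{−n}(w))_n ≠ w_n. -/

import Mathlib

/-- The Cayley machine transformation of a group `G` at state `g`, acting on right-infinite
words `w : ℕ → G`: `(cayley g w) n = g * w 0 * w 1 * ⋯ * w n`. -/
def cayley {G : Type*} [Group G] (g : G) : Equiv.Perm (ℕ → G) where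
  toFun w n := g * ((List.range (n + 1)).map w).prod
  invFun v n :=
    match n with
    | 0 => g⁻¹ * v 0
    | m + 1 => (v m)⁻¹ * v (m + 1)
  left_inv w := by
    funext n
    match n with
    | 0 => simp [List.range_succ]
    | m + 1 => simp [List.range_succ, mul_assoc]
  right_inv v := by
    funext n
    induction n with
    | zero => simp [List.range_succ]
    | succ m ih =>
      beta_reduce at ih ⊢
      rw [List.range_succ, List.map_append, List.prod_append, ← mul_assoc, ih]
      simp [mul_assoc]

/-- The permutation `x = C₁⁻¹`, the inverse of the Cayley machine transformation at the
identity state.  It satisfies `(x w) 0 = w 0` and `(x w) n = (w (n-1))⁻¹ * w n` for `n ≥ 1`. -/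
def xPerm (G : Type*) [Group G] : Equiv.Perm (ℕ → G) := (cayley (1 : G))⁻¹

/-- The permutation `σ_g = x * C_g`, given by `(σ_g w) 0 = g * w 0` and `(σ_g w) n = w n`
for `n ≥ 1`.  The map `g ↦ σ_g` identifies `G` with a subgroup of the automata group. -/
def sigma' {G : Type*} [Group G] (g : G) : Equiv.Perm (ℕ → G) := xPerm G * cayley g

theorem xPerm_apply_succ {G : Type*} [Group G] (w : ℕ → G) (n : ℕ) :
    xPerm G w (n + 1) = (w n)⁻¹ * w (n + 1) := rfl

theorem sigma'_apply_zero {G : Type*} [Group G] (g : G) (w : ℕ → G) :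
    sigma' g w 0 = g * w 0 := by
  change (1 : G)⁻¹ * cayley g w 0 = g * w 0
  simp [cayley]

theorem sigma'_apply_succ {G : Type*} [Group G] (g : G) (w : ℕ → G) (n : ℕ) :
    sigma' g w (n + 1) = w (n + 1) := by
  change (cayley g w n)⁻¹ * cayley g w (n + 1) = w (n + 1)
  simp [cayley, List.range_succ, mul_assoc]

/-- If two words agree beyond position `0`, their images under `xⁿ` agree beyond position `n`. -/
theorem xPerm_pow_apply_eq {G : Type*} [Group G] {u v : ℕ → G}
    (h : ∀ k, u (k + 1) = v (k + 1)) (n : ℕ) {k : ℕ} (hk : n < k) :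
    (xPerm G ^ n) u k = (xPerm G ^ n) v k := by
  induction n generalizing k with
  | zero =>
    obtain ⟨m, rfl⟩ := Nat.exists_eq_succ_of_ne_zero hk.ne'
    exact h m
  | succ n ih =>
    obtain ⟨m, rfl⟩ := Nat.exists_eq_succ_of_ne_zero (Nat.ne_zero_of_lt hk)
    rw [pow_succ', Equiv.Perm.mul_apply, Equiv.Perm.mul_apply, Nat.succ_eq_add_one,
      xPerm_apply_succ, xPerm_apply_succ, ih (by omega : n < m), ih (by omega : n < m + 1)]

/-- If two words differ exactly at position `0`, their images under `xⁿ` differ at position `n`. -/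
theorem xPerm_pow_apply_ne {G : Type*} [Group G] {u v : ℕ → G}
    (h : ∀ k, u (k + 1) = v (k + 1)) (h0 : u 0 ≠ v 0) (n : ℕ) :
    (xPerm G ^ n) u n ≠ (xPerm G ^ n) v n := by
  induction n with
  | zero => exact h0
  | succ n ih =>
    rw [pow_succ', Equiv.Perm.mul_apply, Equiv.Perm.mul_apply, xPerm_apply_succ,
      xPerm_apply_succ, xPerm_pow_apply_eq h n n.lt_succ_self]
    simpa using ih

/-- Let `G` be a finite group.  For every `n ≥ 0` and `g ∈ G`, the permutation
`xⁿ σ_g x⁻ⁿ` of `G^ω` changes only the first `n+1` letters (positions `0, …, n`):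
for every word `w` and every index `k > n`, `(xⁿ σ_g x⁻ⁿ w) k = w k`; moreover if
`g ≠ 1` then some word is changed at position `n`, so the depth is exactly `n + 1`. -/
theorem depth_of_conjugate {G : Type*} [Group G] [Finite G] (n : ℕ) (g : G) :
    (∀ (w : ℕ → G) (k : ℕ), n < k →
      (xPerm G ^ n * sigma' g * (xPerm G ^ n)⁻¹) w k = w k) ∧
    (g ≠ 1 → ∃ w : ℕ → G, (xPerm G ^ n * sigma' g * (xPerm G ^ n)⁻¹) w n ≠ w n) := by
  have key (w : ℕ → G) : w = (xPerm G ^ n) ((xPerm G ^ n)⁻¹ w) :=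
    (Equiv.apply_symm_apply _ w).symm
  refine ⟨fun w k hk => ?_, fun hg => ⟨1, ?_⟩⟩
  · conv_rhs => rw [key w]
    exact xPerm_pow_apply_eq (sigma'_apply_succ g _) n hk
  · conv_rhs => rw [key 1]
    exact xPerm_pow_apply_ne (sigma'_apply_succ g _) (by simpa [sigma'_apply_zero] using hg) n
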